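/- Let y = v_j be a vertex, x ∈ [v_1, v_n] a point with y < x, and i an index with j < i and v_i < x. Define Γ(w) = Φ^{s(i,w)}(x) − Φ^{s(i,w)}(y) for w ∈ [w_i^−, w_i^+]. Then for every w ∈ [w_i^−, w_i^+), the right-derivative Γ'_+(w) = lim_{δ→0+} (Γ(w+δ) − Γ(w))/δ exists and equals τ(x + y − v_{ρ_x(w)} − v_{ρ_y(w)}) + (σ_x(w) − σ_y(w))/c, where ρ_x(w) and σ_x(w) (resp. ρ_y(w) and σ_y(w)) are the head and the weight of the left cluster for x (resp. the right cluster for y) containing v_i under s(i, w). -/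

import Mathlib

open Finset
open scoped Classical

namespace DPN

noncomputable def score (τ c : ℝ) (v w : ℕ → ℝ) (h r j : ℕ) : ℝ :=
  τ * (v h - v j) + (∑ l ∈ Finset.Ioc r j, w l) / c

noncomputable def nextHead (τ c : ℝ) (v w : ℕ → ℝ) (h r : ℕ) : ℕ :=
  (((Finset.Ioc r h).filter (fun j =>
      ∀ j' ∈ Finset.Ioc r h, score τ c v w h r j' ≤ score τ c v w h r j)).max).getD h

noncomputable def heads (τ c : ℝ) (v w : ℕ → ℝ) (h : ℕ) : ℕ → ℕ
  | 0 => 0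
  | m + 1 => nextHead τ c v w h (heads τ c v w h m)

noncomputable def hIdx (n : ℕ) (v : ℕ → ℝ) (x : ℝ) : ℕ :=
  ((Finset.Icc 1 n).filter (fun i => v i < x)).card

noncomputable def phiL (n : ℕ) (τ c : ℝ) (v w : ℕ → ℝ) (x : ℝ) : ℝ :=
  ∑ m ∈ Finset.range n,
    ((∑ l ∈ Finset.Ioc (heads τ c v w (hIdx n v x) m) (heads τ c v w (hIdx n v x) (m + 1)), w l) *
        (τ * (x - v (heads τ c v w (hIdx n v x) (m + 1)))) +
      (∑ l ∈ Finset.Ioc (heads τ c v w (hIdx n v x) m) (heads τ c v w (hIdx n v x) (m + 1)), w l) ^ 2 /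
        (2 * c))

def rv (n : ℕ) (v : ℕ → ℝ) : ℕ → ℝ := fun l => -v (n + 1 - l)

def rw (n : ℕ) (w : ℕ → ℝ) : ℕ → ℝ := fun l => w (n + 1 - l)

noncomputable def phiR (n : ℕ) (τ c : ℝ) (v w : ℕ → ℝ) (x : ℝ) : ℝ :=
  phiL n τ c (rv n v) (rw n w) (-x)

noncomputable def phi (n : ℕ) (τ c : ℝ) (v w : ℕ → ℝ) (x : ℝ) : ℝ :=
  phiL n τ c v w x + phiR n τ c v w x

/-- The set of scenarios: each vertex weight lies in its interval. -/
def scenarios (n : ℕ) (wm wp : ℕ → ℝ) : Set (ℕ → ℝ) :=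
  {s | ∀ i, 1 ≤ i → i ≤ n → wm i ≤ s i ∧ s i ≤ wp i}

/-- The gap `Γ^s(x, y) = Φ^s(x) − Φ^s(y)`. -/
noncomputable def gap (n : ℕ) (τ c : ℝ) (v s : ℕ → ℝ) (x y : ℝ) : ℝ :=
  phi n τ c v s x - phi n τ c v s y

/-- The regret `R^s(x) = Φ^s(x) − Φ^s(m^s)` (`Φ^s(m^s)` = min of `Φ^s` on `[v_1, v_n]`). -/
noncomputable def regret (n : ℕ) (τ c : ℝ) (v s : ℕ → ℝ) (x : ℝ) : ℝ :=
  phi n τ c v s x - sInf ((fun z => phi n τ c v s z) '' Set.Icc (v 1) (v n))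

/-- The maximum regret `R_max(x) = sup_{s ∈ S} R^s(x)`. -/
noncomputable def maxRegret (n : ℕ) (τ c : ℝ) (v wm wp : ℕ → ℝ) (x : ℝ) : ℝ :=
  sSup {r | ∃ s ∈ scenarios n wm wp, r = regret n τ c v s x}

/-- The left-pseudo-bipartite scenario `s(i, w)`. -/
def pseudoBipL (wm wp : ℕ → ℝ) (i : ℕ) (w : ℝ) : ℕ → ℝ :=
  fun l => if l < i then wp l else if l = i then w else wm l

/-- The right-pseudo-bipartite scenario `s(i, w)`. -/
def pseudoBipR (wm wp : ℕ → ℝ) (i : ℕ) (w : ℝ) : ℕ → ℝ :=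
  fun l => if l < i then wm l else if l = i then w else wp l

/-- The head `ρ_m` of the left cluster containing vertex `i`: the smallest cluster head `≥ i`. -/
noncomputable def clusterHeadOf (τ c : ℝ) (v w : ℕ → ℝ) (h i : ℕ) : ℕ :=
  ((((Finset.range (h + 1)).image (heads τ c v w h)).filter (fun r => i ≤ r)).min).getD h

/-- The head `ρ_{m−1}` preceding the left cluster containing vertex `i`:
the largest cluster head `< i`. -/
noncomputable def prevClusterHeadOf (τ c : ℝ) (v w : ℕ → ℝ) (h i : ℕ) : ℕ :=
  ((((Finset.range (h + 1)).image (heads τ c v w h)).filter (fun r => r < i)).max).getD 0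

/-- The weight `σ_m` of the left cluster containing vertex `i`. -/
noncomputable def clusterWeightOf (τ c : ℝ) (v w : ℕ → ℝ) (h i : ℕ) : ℝ :=
  ∑ l ∈ Finset.Ioc (prevClusterHeadOf τ c v w h i) (clusterHeadOf τ c v w h i), w l

/-- The sequence of right cluster heads for the vertex `y = v_j`
(expressed in the coordinates of the reflected network). -/
noncomputable def rightHeads (n : ℕ) (τ c : ℝ) (v w : ℕ → ℝ) (j : ℕ) : ℕ → ℕ :=
  heads τ c (rv n v) (rw n w) (hIdx n (rv n v) (-(v j)))

/-- The sequence of left cluster heads for the vertex `y = v_j`. -/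
noncomputable def leftHeads (n : ℕ) (τ c : ℝ) (v w : ℕ → ℝ) (j : ℕ) : ℕ → ℕ :=
  heads τ c v w (hIdx n v (v j))

/-- The (original-coordinates) index of the head of the right cluster for `y = v_j`
containing vertex `i`. -/
noncomputable def rightClusterHeadOf (n : ℕ) (τ c : ℝ) (v w : ℕ → ℝ) (j i : ℕ) : ℕ :=
  n + 1 - clusterHeadOf τ c (rv n v) (rw n w) (hIdx n (rv n v) (-(v j))) (n + 1 - i)

/-- The weight of the right cluster for `y = v_j` containing vertex `i`. -/
noncomputable def rightClusterWeightOf (n : ℕ) (τ c : ℝ) (v w : ℕ → ℝ) (j i : ℕ) : ℝ :=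
  clusterWeightOf τ c (rv n v) (rw n w) (hIdx n (rv n v) (-(v j))) (n + 1 - i)

/-- `ω` is a critical weight for `v_i` with respect to the vertex `y = v_j`
(left-pseudo-bipartite case): `ω ∈ {w_i^−, w_i^+}` or the right-cluster partition for `y`
under `s(i, ·)` is not constant on any neighborhood of `ω` in `[w_i^−, w_i^+]`. -/
def criticalWeightL (n : ℕ) (τ c : ℝ) (v wm wp : ℕ → ℝ) (j i : ℕ) (ω : ℝ) : Prop :=
  ω ∈ Set.Icc (wm i) (wp i) ∧
    (ω = wm i ∨ ω = wp i ∨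
      ¬ ∃ ε > (0 : ℝ), ∀ w ∈ Set.Icc (wm i) (wp i), |w - ω| < ε →
        rightHeads n τ c v (pseudoBipL wm wp i w) j =
          rightHeads n τ c v (pseudoBipL wm wp i ω) j)

/-- `ω` is a critical weight for `v_i` with respect to the vertex `y = v_j`
(right-pseudo-bipartite case, using the left-cluster partition for `y`). -/
def criticalWeightR (n : ℕ) (τ c : ℝ) (v wm wp : ℕ → ℝ) (j i : ℕ) (ω : ℝ) : Prop :=
  ω ∈ Set.Icc (wm i) (wp i) ∧
    (ω = wm i ∨ ω = wp i ∨
      ¬ ∃ ε > (0 : ℝ), ∀ w ∈ Set.Icc (wm i) (wp i), |w - ω| < ε →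
        leftHeads n τ c v (pseudoBipR wm wp i w) j =
          leftHeads n τ c v (pseudoBipR wm wp i ω) j)

/-- `Q`: the number of right clusters for `y = v_j` under weights `w` that lie entirely
to the right of the right cluster containing `v_i` (counted via reflected cluster heads). -/
noncomputable def Qnum (n : ℕ) (τ c : ℝ) (v w : ℕ → ℝ) (j i : ℕ) : ℕ :=
  (((Finset.range (n + 1)).image (rightHeads n τ c v w j)).filter
      (fun r => 1 ≤ r ∧
        r < clusterHeadOf τ c (rv n v) (rw n w) (hIdx n (rv n v) (-(v j))) (n + 1 - i))).card

end DPN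

open DPN

namespace DPN

section Heads

variable {τ c : ℝ} {v w : ℕ → ℝ} {h r : ℕ}

lemma nextHead_of_le (hr : h ≤ r) : nextHead τ c v w h r = h := by
  simp [nextHead, Finset.Ioc_eq_empty_of_le hr, Option.getD]

lemma nextHead_spec (hr : r < h) :
    nextHead τ c v w h r ∈ Finset.Ioc r h ∧
      (∀ k ∈ Finset.Ioc r h, score τ c v w h r k ≤ score τ c v w h r (nextHead τ c v w h r)) ∧
      ∀ k ∈ Finset.Ioc r h, nextHead τ c v w h r < k →
        score τ c v w h r k < score τ c v w h r (nextHead τ c v w h r) := by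
  set S := (Finset.Ioc r h).filter (fun j =>
    ∀ j' ∈ Finset.Ioc r h, score τ c v w h r j' ≤ score τ c v w h r j) with hS
  obtain ⟨a, ha, hmax⟩ := Finset.exists_max_image (Finset.Ioc r h) (score τ c v w h r)
    ⟨h, by simp [hr]⟩
  obtain ⟨b, hb⟩ := Finset.max_of_mem (s := S) (Finset.mem_filter.2 ⟨ha, hmax⟩)
  have hn : nextHead τ c v w h r = b := by
    change S.max.getD h = b
    rw [hb]; rfl
  rw [hn]
  have hbS := Finset.mem_filter.1 (Finset.mem_of_max hb)
  refine ⟨hbS.1, hbS.2, fun k hk hbk => lt_of_not_ge fun hle => ?_⟩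
  have hkS : k ∈ S := Finset.mem_filter.2 ⟨hk, fun j hj => (hbS.2 j hj).trans hle⟩
  exact absurd (Finset.le_max_of_eq hkS hb) (not_le.2 hbk)

lemma nextHead_eq {k : ℕ} (hk : k ∈ Finset.Ioc r h)
    (h₁ : ∀ j ∈ Finset.Ioc r h, score τ c v w h r j ≤ score τ c v w h r k)
    (h₂ : ∀ j ∈ Finset.Ioc r h, k < j → score τ c v w h r j < score τ c v w h r k) :
    nextHead τ c v w h r = k := by
  obtain ⟨hm, hle, hlt⟩ := nextHead_spec (τ := τ) (c := c) (v := v) (w := w)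
    ((Finset.mem_Ioc.1 hk).1.trans_le (Finset.mem_Ioc.1 hk).2)
  rcases lt_trichotomy (nextHead τ c v w h r) k with hh | hh | hh
  · exact absurd (h₁ _ hm) (not_le.2 (hlt k hk hh))
  · exact hh
  · exact absurd (hle k hk) (not_le.2 (h₂ _ hm hh))

lemma nextHead_le : nextHead τ c v w h r ≤ h := by
  rcases le_or_gt h r with hr | hr
  · exact (nextHead_of_le hr).le
  · exact (Finset.mem_Ioc.1 (nextHead_spec hr).1).2

lemma heads_le (m : ℕ) : heads τ c v w h m ≤ h := by
  cases m with
  | zero => exact Nat.zero_le h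
  | succ m => exact nextHead_le

lemma heads_lt_succ {m : ℕ} (hm : heads τ c v w h m < h) :
    heads τ c v w h m < heads τ c v w h (m + 1) :=
  (Finset.mem_Ioc.1 (nextHead_spec hm).1).1

lemma heads_monotone : Monotone (heads τ c v w h) := by
  refine monotone_nat_of_le_succ fun m => ?_
  rcases (heads_le (τ := τ) (c := c) (v := v) (w := w) (h := h) m).lt_or_eq with hm | hm
  · exact (heads_lt_succ hm).le
  · exact hm.trans_le (nextHead_of_le hm.ge).ge

lemma min_le_heads (m : ℕ) : min m h ≤ heads τ c v w h m := by
  induction m with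
  | zero => simp
  | succ m ih =>
    rcases (heads_le (τ := τ) (c := c) (v := v) (w := w) (h := h) m).lt_or_eq with hm | hm
    · have := heads_lt_succ hm
      omega
    · have := heads_monotone (τ := τ) (c := c) (v := v) (w := w) (h := h) (Nat.le_succ m)
      simp only [Nat.succ_eq_add_one] at this
      omega

/-- Every vertex up to `h` lies in a cluster. -/
lemma exists_cluster {i : ℕ} (hi : 1 ≤ i) (hih : i ≤ h) :
    ∃ m < h, heads τ c v w h m < i ∧ i ≤ heads τ c v w h (m + 1) := by
  have hex : ∃ k, i ≤ heads τ c v w h k :=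
    ⟨h, hih.trans (by simpa using min_le_heads (τ := τ) (c := c) (v := v) (w := w) (h := h) h)⟩
  obtain ⟨m, hm⟩ : ∃ m, Nat.find hex = m + 1 := by
    refine Nat.exists_eq_succ_of_ne_zero fun h0 => ?_
    have := Nat.find_spec hex
    rw [h0] at this
    change i ≤ 0 at this
    omega
  have h₁ : heads τ c v w h m < i := not_le.1 (Nat.find_min hex (by omega))
  have h₂ := min_le_heads (τ := τ) (c := c) (v := v) (w := w) (h := h) m
  exact ⟨m, by omega, h₁, hm ▸ Nat.find_spec hex⟩

lemma clusterHeadOf_eq {i m : ℕ} (hm : m < h) (h₁ : heads τ c v w h m < i)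
    (h₂ : i ≤ heads τ c v w h (m + 1)) :
    clusterHeadOf τ c v w h i = heads τ c v w h (m + 1) := by
  set S := ((Finset.range (h + 1)).image (heads τ c v w h)).filter (fun r => i ≤ r) with hS
  have hmem : heads τ c v w h (m + 1) ∈ S :=
    Finset.mem_filter.2 ⟨Finset.mem_image_of_mem _ (Finset.mem_range.2 (by omega)), h₂⟩
  obtain ⟨b, hb⟩ := Finset.min_of_mem hmem
  have hn : clusterHeadOf τ c v w h i = b := by
    change S.min.getD h = b
    rw [hb]; rfl
  rw [hn]
  refine le_antisymm (Finset.min_le_of_eq hmem hb) ?_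
  obtain ⟨hbi, hib⟩ := Finset.mem_filter.1 (Finset.mem_of_min hb)
  obtain ⟨k, -, rfl⟩ := Finset.mem_image.1 hbi
  refine heads_monotone (not_lt.1 fun hk => ?_)
  have := heads_monotone (τ := τ) (c := c) (v := v) (w := w) (h := h) (Nat.lt_succ_iff.1 hk)
  omega

lemma prevClusterHeadOf_eq {i m : ℕ} (hm : m < h) (h₁ : heads τ c v w h m < i)
    (h₂ : i ≤ heads τ c v w h (m + 1)) :
    prevClusterHeadOf τ c v w h i = heads τ c v w h m := by
  set S := ((Finset.range (h + 1)).image (heads τ c v w h)).filter (fun r => r < i) with hS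
  have hmem : heads τ c v w h m ∈ S :=
    Finset.mem_filter.2 ⟨Finset.mem_image_of_mem _ (Finset.mem_range.2 (by omega)), h₁⟩
  obtain ⟨b, hb⟩ := Finset.max_of_mem hmem
  have hn : prevClusterHeadOf τ c v w h i = b := by
    change S.max.getD 0 = b
    rw [hb]; rfl
  rw [hn]
  refine le_antisymm ?_ (Finset.le_max_of_eq hmem hb)
  obtain ⟨hbi, hib⟩ := Finset.mem_filter.1 (Finset.mem_of_max hb)
  obtain ⟨k, -, rfl⟩ := Finset.mem_image.1 hbi
  refine heads_monotone (not_lt.1 fun hk => ?_)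
  have := heads_monotone (τ := τ) (c := c) (v := v) (w := w) (h := h) (Nat.succ_le_of_lt hk)
  simp only [Nat.succ_eq_add_one] at this
  omega

end Heads

/-- The weights `w` with the weight of vertex `i` increased by `δ`. -/
def bump (w : ℕ → ℝ) (i : ℕ) (δ : ℝ) : ℕ → ℝ := fun l => w l + if l = i then δ else 0

lemma sum_Ioc_bump (w : ℕ → ℝ) (i : ℕ) (δ : ℝ) (a b : ℕ) :
    ∑ l ∈ Finset.Ioc a b, bump w i δ l =
      ∑ l ∈ Finset.Ioc a b, w l + if a < i ∧ i ≤ b then δ else 0 := by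
  simp [bump, Finset.sum_add_distrib]

lemma score_bump (τ c : ℝ) (v w : ℕ → ℝ) (h r k i : ℕ) (δ : ℝ) :
    score τ c v (bump w i δ) h r k =
      score τ c v w h r k + if r < i ∧ i ≤ k then δ / c else 0 := by
  rw [score, score, sum_Ioc_bump]
  split_ifs <;> ring

lemma nextHead_bump_of_lt {τ c : ℝ} {v w : ℕ → ℝ} {h i : ℕ} (hi : h < i) (δ : ℝ) (r : ℕ) :
    nextHead τ c v (bump w i δ) h r = nextHead τ c v w h r := by
  rcases le_or_gt h r with hr | hr
  · rw [nextHead_of_le hr, nextHead_of_le hr]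
  obtain ⟨h₀, h₁, h₂⟩ := nextHead_spec (τ := τ) (c := c) (v := v) (w := w) hr
  have key : ∀ k ∈ Finset.Ioc r h,
      score τ c v (bump w i δ) h r k = score τ c v w h r k := fun k hk => by
    rw [score_bump, if_neg (by have := (Finset.mem_Ioc.1 hk).2; omega), add_zero]
  refine nextHead_eq h₀ (fun k hk => ?_) (fun k hk hlt => ?_)
  · rw [key k hk, key _ h₀]; exact h₁ k hk
  · rw [key k hk, key _ h₀]; exact h₂ k hk hlt

lemma eventually_nextHead_bump {τ c : ℝ} (hc : 0 < c) (v w : ℕ → ℝ) (h i r : ℕ) :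
    ∀ᶠ δ in nhdsWithin (0 : ℝ) (Set.Ioi 0),
      nextHead τ c v (bump w i δ) h r = nextHead τ c v w h r := by
  rcases le_or_gt h r with hr | hr
  · exact Filter.Eventually.of_forall fun δ => by rw [nextHead_of_le hr, nextHead_of_le hr]
  obtain ⟨h₀, h₁, h₂⟩ := nextHead_spec (τ := τ) (c := c) (v := v) (w := w) hr
  set a := nextHead τ c v w h r
  have hsmall : ∀ᶠ δ in nhdsWithin (0 : ℝ) (Set.Ioi 0), ∀ k ∈ Finset.Ioc r h, a < k →
      score τ c v w h r k + δ / c < score τ c v w h r a := by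
    rw [Filter.eventually_all_finset]
    intro k hk
    by_cases hak : a < k
    · have ht : Filter.Tendsto (fun δ : ℝ => score τ c v w h r k + δ / c)
          (nhdsWithin 0 (Set.Ioi 0)) (nhds (score τ c v w h r k + 0 / c)) :=
        Filter.Tendsto.mono_left (Continuous.tendsto (by fun_prop) 0) nhdsWithin_le_nhds
      have := ht.eventually_lt_const (u := score τ c v w h r a) (by simpa using h₂ k hk hak)
      filter_upwards [this] with δ hδ _ using hδ
    · exact Filter.Eventually.of_forall fun δ hlt => absurd hlt hak
  filter_upwards [hsmall, self_mem_nhdsWithin] with δ hδ hpos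
  have hδc : 0 < δ / c := div_pos hpos hc
  refine nextHead_eq h₀ (fun k hk => ?_) (fun k hk hlt => ?_)
  · rw [score_bump, score_bump]
    have e₁ := h₁ k hk
    rcases le_or_gt k a with hka | hka
    · split_ifs
      · linarith
      · omega
      · linarith
      · linarith
    · have e₂ := hδ k hk hka
      split_ifs <;> linarith
  · rw [score_bump, score_bump]
    have e₁ := h₂ k hk hlt
    have e₂ := hδ k hk hlt
    split_ifs <;> linarith

lemma heads_bump_of_nextHead {τ c : ℝ} {v w : ℕ → ℝ} {h i : ℕ} {δ : ℝ}
    (H : ∀ r ≤ h, nextHead τ c v (bump w i δ) h r = nextHead τ c v w h r) :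
    heads τ c v (bump w i δ) h = heads τ c v w h := by
  funext m
  induction m with
  | zero => rfl
  | succ m ih =>
    change nextHead _ _ _ _ _ _ = nextHead _ _ _ _ _ _
    rw [ih]
    exact H _ (heads_le m)

/-- The cluster partition does not change under a small increase of a single weight. -/
lemma eventually_heads_bump {τ c : ℝ} (hc : 0 < c) (v w : ℕ → ℝ) (h i : ℕ) :
    ∀ᶠ δ in nhdsWithin (0 : ℝ) (Set.Ioi 0),
      heads τ c v (bump w i δ) h = heads τ c v w h := by
  have : ∀ᶠ δ in nhdsWithin (0 : ℝ) (Set.Ioi 0), ∀ r ∈ Finset.range (h + 1),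
      nextHead τ c v (bump w i δ) h r = nextHead τ c v w h r := by
    rw [Filter.eventually_all_finset]
    exact fun r _ => eventually_nextHead_bump hc v w h i r
  filter_upwards [this] with δ hδ
  exact heads_bump_of_nextHead fun r hr => hδ r (Finset.mem_range.2 (by omega))

lemma phiL_bump_of_lt {n : ℕ} {τ c : ℝ} {v w : ℕ → ℝ} {x : ℝ} {i : ℕ} (hi : hIdx n v x < i)
    (δ : ℝ) : phiL n τ c v (bump w i δ) x = phiL n τ c v w x := by
  rw [phiL, phiL, heads_bump_of_nextHead fun r _ => nextHead_bump_of_lt hi δ r]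
  refine Finset.sum_congr rfl fun m _ => ?_
  have := heads_le (τ := τ) (c := c) (v := v) (w := w) (h := hIdx n v x) (m + 1)
  rw [sum_Ioc_bump, if_neg (by omega), add_zero]

lemma hIdx_le (n : ℕ) (v : ℕ → ℝ) (x : ℝ) : hIdx n v x ≤ n := by
  simpa [hIdx] using Finset.card_filter_le (Finset.Icc 1 n) (fun i => v i < x)

lemma eventually_phiL_bump {n : ℕ} {τ c : ℝ} (hc : 0 < c) {v w : ℕ → ℝ} {x : ℝ} {i : ℕ}
    (hi : 1 ≤ i) (hih : i ≤ hIdx n v x) :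
    ∀ᶠ δ in nhdsWithin (0 : ℝ) (Set.Ioi 0),
      phiL n τ c v (bump w i δ) x - phiL n τ c v w x =
        δ * (τ * (x - v (clusterHeadOf τ c v w (hIdx n v x) i)) +
          clusterWeightOf τ c v w (hIdx n v x) i / c) + δ ^ 2 / (2 * c) := by
  filter_upwards [eventually_heads_bump (τ := τ) hc v w (hIdx n v x) i] with δ hδ
  obtain ⟨m, hm, h₁, h₂⟩ := exists_cluster (τ := τ) (c := c) (v := v) (w := w) hi hih
  rw [clusterWeightOf, clusterHeadOf_eq hm h₁ h₂, prevClusterHeadOf_eq hm h₁ h₂,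
    phiL, phiL, hδ, ← Finset.sum_sub_distrib,
    Finset.sum_eq_single_of_mem m (Finset.mem_range.2 (hm.trans_le (hIdx_le n v x)))]
  · rw [sum_Ioc_bump, if_pos ⟨h₁, h₂⟩]
    field_simp
    ring
  · intro k _ hkm
    rw [sum_Ioc_bump, if_neg, add_zero, sub_self]
    rintro ⟨h₃, h₄⟩
    have hmono := heads_monotone (τ := τ) (c := c) (v := v) (w := w) (h := hIdx n v x)
    rcases lt_or_gt_of_ne hkm with hlt | hlt
    · exact absurd (hmono (Nat.succ_le_of_lt hlt)) (by simp only [Nat.succ_eq_add_one]; omega)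
    · exact absurd (hmono (Nat.succ_le_of_lt hlt)) (by simp only [Nat.succ_eq_add_one]; omega)

lemma le_hIdx {n : ℕ} {v : ℕ → ℝ} (hv : StrictMonoOn v (Set.Icc 1 n)) {x : ℝ} {i : ℕ}
    (hin : i ≤ n) (hix : v i < x) : i ≤ hIdx n v x := by
  have hsub : Finset.Icc 1 i ⊆ (Finset.Icc 1 n).filter (fun k => v k < x) := fun k hk => by
    obtain ⟨hk₁, hk₂⟩ := Finset.mem_Icc.1 hk
    exact Finset.mem_filter.2 ⟨Finset.mem_Icc.2 ⟨hk₁, hk₂.trans hin⟩,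
      (hv.monotoneOn ⟨hk₁, hk₂.trans hin⟩ ⟨hk₁.trans hk₂, hin⟩ hk₂).trans_lt hix⟩
  simpa [hIdx] using Finset.card_le_card hsub

lemma hIdx_lt {n : ℕ} {v : ℕ → ℝ} (hv : StrictMonoOn v (Set.Icc 1 n)) {x : ℝ} {i : ℕ}
    (hi : 1 ≤ i) (hin : i ≤ n) (hix : x ≤ v i) : hIdx n v x < i := by
  have hsub : (Finset.Icc 1 n).filter (fun k => v k < x) ⊆ Finset.Ico 1 i := fun k hk => by
    obtain ⟨hk, hkx⟩ := Finset.mem_filter.1 hk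
    obtain ⟨hk₁, hk₂⟩ := Finset.mem_Icc.1 hk
    refine Finset.mem_Ico.2 ⟨hk₁, (hv.lt_iff_lt ⟨hk₁, hk₂⟩ ⟨hi, hin⟩).1 (hkx.trans_le hix)⟩
  have := Finset.card_le_card hsub
  rw [Nat.card_Ico] at this
  change hIdx n v x ≤ _ at this
  omega

lemma strictMonoOn_rv {n : ℕ} {v : ℕ → ℝ} (hv : StrictMonoOn v (Set.Icc 1 n)) :
    StrictMonoOn (rv n v) (Set.Icc 1 n) := by
  rintro a ⟨ha₁, ha₂⟩ b ⟨hb₁, hb₂⟩ hab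
  exact neg_lt_neg (hv ⟨by omega, by omega⟩ ⟨by omega, by omega⟩ (by omega))

lemma rv_reflect {n i : ℕ} (v : ℕ → ℝ) (hin : i ≤ n) : rv n v (n + 1 - i) = -v i := by
  rw [rv, Nat.sub_sub_self (by omega)]

lemma rw_bump {n i : ℕ} (w : ℕ → ℝ) (hi : 1 ≤ i) (hin : i ≤ n) (δ : ℝ) :
    DPN.rw n (bump w i δ) = bump (DPN.rw n w) (n + 1 - i) δ := by
  funext l
  have : n + 1 - l = i ↔ l = n + 1 - i := by omega
  simp only [DPN.rw, bump, this]

lemma pseudoBipL_add (wm wp : ℕ → ℝ) (i : ℕ) (w δ : ℝ) :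
    pseudoBipL wm wp i (w + δ) = bump (pseudoBipL wm wp i w) i δ := by
  funext l
  rcases lt_trichotomy l i with hl | hl | hl
  · simp [pseudoBipL, bump, hl, hl.ne]
  · simp [pseudoBipL, bump, hl]
  · simp [pseudoBipL, bump, hl.not_gt, hl.ne']

end DPN

theorem stmt14 (n : ℕ) (τ c : ℝ) (hτ : 0 < τ) (hc : 0 < c) (v : ℕ → ℝ)
    (hv : ∀ i, 1 ≤ i → i < n → v i < v (i + 1))
    (wm wp : ℕ → ℝ) (hwm : ∀ i, 1 ≤ i → i ≤ n → 0 < wm i)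
    (hwmp : ∀ i, 1 ≤ i → i ≤ n → wm i ≤ wp i)
    (j : ℕ) (hj1 : 1 ≤ j) (hjn : j ≤ n)
    (x : ℝ) (hx : x ∈ Set.Icc (v 1) (v n)) (hyx : v j < x)
    (i : ℕ) (hji : j < i) (hin : i ≤ n) (hix : v i < x)
    (w : ℝ) (hw : w ∈ Set.Ico (wm i) (wp i)) :
    Filter.Tendsto
      (fun δ : ℝ =>
        (gap n τ c v (pseudoBipL wm wp i (w + δ)) x (v j) -
            gap n τ c v (pseudoBipL wm wp i w) x (v j)) / δ)
      (nhdsWithin 0 (Set.Ioi 0))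
      (nhds (τ * (x + v j - v (clusterHeadOf τ c v (pseudoBipL wm wp i w) (hIdx n v x) i) -
          v (rightClusterHeadOf n τ c v (pseudoBipL wm wp i w) j i)) +
        (clusterWeightOf τ c v (pseudoBipL wm wp i w) (hIdx n v x) i -
            rightClusterWeightOf n τ c v (pseudoBipL wm wp i w) j i) / c)) := by
  have hmono : StrictMonoOn v (Set.Icc 1 n) :=
    strictMonoOn_of_lt_add_one Set.ordConnected_Icc fun a _ ha ha' => hv a ha.1 ha'.2
  have hrmono := strictMonoOn_rv hmono
  have hi1 : 1 ≤ i := hj1.trans hji.le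
  have hji' : v j < v i := hmono ⟨hj1, hjn⟩ ⟨hi1, hin⟩ hji
  have hr1 : 1 ≤ n + 1 - i := by omega
  have hrn : n + 1 - i ≤ n := by omega
  have hrx : hIdx n (rv n v) (-x) < n + 1 - i :=
    hIdx_lt hrmono hr1 hrn (by rw [rv_reflect v hin]; exact neg_le_neg hix.le)
  have hry : n + 1 - i ≤ hIdx n (rv n v) (-v j) :=
    le_hIdx hrmono hrn (by rw [rv_reflect v hin]; exact neg_lt_neg hji')
  set s := pseudoBipL wm wp i w
  refine tendsto_const_nhds.congr' ?_
  filter_upwards [self_mem_nhdsWithin,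
    eventually_phiL_bump (τ := τ) (w := s) hc hi1 (le_hIdx hmono hin hix),
    eventually_phiL_bump (τ := τ) (w := DPN.rw n s) hc hr1 hry] with δ hδ hL hR
  have hδ0 : δ ≠ 0 := ne_of_gt hδ
  have hv' : v (rightClusterHeadOf n τ c v s j i) =
      -rv n v (clusterHeadOf τ c (rv n v) (DPN.rw n s) (hIdx n (rv n v) (-(v j))) (n + 1 - i)) :=
    (neg_neg _).symm
  rw [eq_div_iff hδ0, pseudoBipL_add, gap, gap, phi, phi, phi, phi, phiR, phiR, phiR, phiR,
    rw_bump s hi1 hin, phiL_bump_of_lt hrx,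
    phiL_bump_of_lt (hIdx_lt hmono hi1 hin hji'.le), hv', rightClusterWeightOf]
  linear_combination hR - hL
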